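/- arXiv:2012.11400 — 5 statements merged into one kernel-verified Lean document; each statement's English description precedes it below -/
import Mathlib

section
/- Let r, m be positive integers and let p, q be real numbers with 0 < q < p. Let A be the fully-connected planted partition weight matrix on the vertex set V = Fin r × Fin m, i.e. A (u,a) (v,b) = p if u = v and A (u,a) (v,b) = q if u ≠ v. Then for every integer l ≥ 1 and all vertices i, j, k ∈ V such that i and j lie in the same cluster (equal first components) while k lies in a different cluster from i, the (i,k) entry of A^l is strictly smaller than the (i,j) entry of A^l. -/
/-- The product of two matrices that are constant on and off the diagonal cluster blocks is again
of this form. -/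
lemma sum_block_mul_block (r m : ℕ) (a b c d : ℝ) (s t : Fin r) :
    ∑ w : Fin r × Fin m, (b + if s = w.1 then a else 0) * (d + if w.1 = t then c else 0) =
      (r * m * b * d + m * b * c + m * a * d) + if s = t then m * a * c else 0 := by
  rw [Fintype.sum_prod_type]
  simp only [add_mul, mul_add, Finset.sum_add_distrib, mul_ite, mul_zero, Finset.sum_ite_eq,
    Finset.sum_ite_eq', Finset.mem_univ, if_true, ite_mul, zero_mul, Finset.sum_const,
    Finset.card_univ, Fintype.card_fin, nsmul_eq_mul]
  split_ifs <;> ring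

/-- Every positive power of the planted partition matrix is constant on and off the cluster blocks,
with a strictly larger value on the blocks. -/
lemma exists_planted_partition_pow_apply (r m : ℕ) (hm : 0 < m) (p q : ℝ) (hqp : q < p)
    (A : Matrix (Fin r × Fin m) (Fin r × Fin m) ℝ)
    (hA : ∀ u v : Fin r × Fin m, A u v = if u.1 = v.1 then p else q) (n : ℕ) :
    ∃ a b : ℝ, 0 < a ∧ ∀ u v, (A ^ (n + 1)) u v = b + if u.1 = v.1 then a else 0 := by
  have hA' (u v : Fin r × Fin m) : A u v = q + if u.1 = v.1 then p - q else 0 := by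
    rw [hA]
    split_ifs <;> ring
  induction n with
  | zero => exact ⟨p - q, q, sub_pos.2 hqp, by simpa using hA'⟩
  | succ n ih =>
    obtain ⟨a, b, ha, h⟩ := ih
    have hm' : (0 : ℝ) < m := Nat.cast_pos.2 hm
    refine ⟨m * a * (p - q), r * m * b * q + m * b * (p - q) + m * a * q,
      mul_pos (mul_pos hm' ha) (sub_pos.2 hqp), fun u v => ?_⟩
    rw [pow_succ, Matrix.mul_apply, ← sum_block_mul_block]
    simp only [h, hA']

theorem stmt0 (r m : ℕ) (hr : 0 < r) (hm : 0 < m) (p q : ℝ) (hq : 0 < q) (hqp : q < p)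
    (A : Matrix (Fin r × Fin m) (Fin r × Fin m) ℝ)
    (hA : ∀ u v : Fin r × Fin m, A u v = if u.1 = v.1 then p else q)
    (l : ℕ) (hl : 1 ≤ l)
    (i j k : Fin r × Fin m) (hij : i.1 = j.1) (hik : i.1 ≠ k.1) :
    (A ^ l) i k < (A ^ l) i j := by
  obtain ⟨n, rfl⟩ := Nat.exists_eq_add_of_le' hl
  obtain ⟨a, b, ha, h⟩ := exists_planted_partition_pow_apply r m hm p q hqp A hA n
  rw [h, h, if_neg hik, if_pos hij]
  linarith
end

section
/- Let r, m be positive integers, p, q real numbers with 0 < q < p, and A the fully-connected planted partition weight matrix on V = Fin r × Fin m. Let L ≥ 1 and let w₁, …, w_L be nonnegative reals, at least one of which is strictly positive, and set S = w₁·A + w₂·A² + ⋯ + w_L·A^L. Then for all vertices i, j, k ∈ V with i and j in the same cluster and k in a different cluster from i, the (i,k) entry of S is strictly smaller than the (i,j) entry of S. -/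
/-- Right multiplication by a planted partition matrix preserves the property that a row is
strictly larger on one cluster than on another. -/
theorem planted_partition_sum_lt {r m : ℕ} (hm : 0 < m) {p q : ℝ} (hqp : q < p)
    {A : Matrix (Fin r × Fin m) (Fin r × Fin m) ℝ}
    (hA : ∀ u v : Fin r × Fin m, A u v = if u.1 = v.1 then p else q)
    (x : Fin r × Fin m → ℝ) (j k : Fin r × Fin m)
    (h : ∀ a, x (k.1, a) < x (j.1, a)) :
    ∑ v, x v * A v k < ∑ v, x v * A v j := by
  have sum_eq (l : Fin r × Fin m) :
      ∑ v, x v * A v l = q * ∑ v, x v + (p - q) * ∑ a, x (l.1, a) := by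
    have entry (v : Fin r × Fin m) :
        x v * A v l = q * x v + (p - q) * if v.1 = l.1 then x v else 0 := by
      rw [hA]; split_ifs <;> ring
    simp_rw [entry, Finset.sum_add_distrib, ← Finset.mul_sum]
    congr 2
    rw [Fintype.sum_prod_type_right]
    simp
  have : Nonempty (Fin m) := ⟨⟨0, hm⟩⟩
  have hsum : ∑ a, x (k.1, a) < ∑ a, x (j.1, a) :=
    Finset.sum_lt_sum_of_nonempty Finset.univ_nonempty fun a _ => h a
  rw [sum_eq, sum_eq]
  have := mul_lt_mul_of_pos_left hsum (sub_pos.2 hqp)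
  linarith

theorem planted_partition_pow_lt {r m : ℕ} (hm : 0 < m) {p q : ℝ} (hqp : q < p)
    {A : Matrix (Fin r × Fin m) (Fin r × Fin m) ℝ}
    (hA : ∀ u v : Fin r × Fin m, A u v = if u.1 = v.1 then p else q) (n : ℕ)
    {i j k : Fin r × Fin m} (hij : i.1 = j.1) (hik : i.1 ≠ k.1) :
    (A ^ (n + 1)) i k < (A ^ (n + 1)) i j := by
  induction n generalizing j k with
  | zero => simpa [hA, hij, hij ▸ hik] using hqp
  | succ n ih =>
    rw [pow_succ, Matrix.mul_apply, Matrix.mul_apply]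
    exact planted_partition_sum_lt hm hqp hA _ j k fun _ => ih hij hik

theorem stmt1 (r m : ℕ) (hr : 0 < r) (hm : 0 < m) (p q : ℝ) (hq : 0 < q) (hqp : q < p)
    (A : Matrix (Fin r × Fin m) (Fin r × Fin m) ℝ)
    (hA : ∀ u v : Fin r × Fin m, A u v = if u.1 = v.1 then p else q)
    (L : ℕ) (hL : 1 ≤ L) (w : Fin L → ℝ)
    (hw : ∀ t, 0 ≤ w t) (hw' : ∃ t, 0 < w t)
    (S : Matrix (Fin r × Fin m) (Fin r × Fin m) ℝ)
    (hS : S = ∑ t : Fin L, w t • A ^ ((t : ℕ) + 1))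
    (i j k : Fin r × Fin m) (hij : i.1 = j.1) (hik : i.1 ≠ k.1) :
    S i k < S i j := by
  have hpow (t : Fin L) := planted_partition_pow_lt hm hqp hA t hij hik
  obtain ⟨t₀, ht₀⟩ := hw'
  simp only [hS, Matrix.sum_apply, Matrix.smul_apply, smul_eq_mul]
  exact Finset.sum_lt_sum (fun t _ => mul_le_mul_of_nonneg_left (hpow t).le (hw t))
    ⟨t₀, Finset.mem_univ _, mul_lt_mul_of_pos_left (hpow t₀) ht₀⟩
end

section
/- Let r, m be positive integers, p, q real numbers, and A the matrix on V = Fin r × Fin m with A (u,a) (v,b) = p if u = v and q otherwise. Then for every integer l ≥ 1 and all vertices i, j, k ∈ V with i and j in the same cluster and k in a different cluster from i, the differences of entries satisfy the recursion (A^{l+1})_{ij} − (A^{l+1})_{ik} = m·(p − q)·((A^l)_{ij} − (A^l)_{ik}). -/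
/-- Positive powers of a matrix inherit equality of columns. -/
theorem Matrix.pow_apply_eq_of_col_eq {n R : Type*} [Fintype n] [DecidableEq n] [Semiring R]
    (A : Matrix n n R) {v w : n} (h : ∀ u, A u v = A u w) {l : ℕ} (hl : 1 ≤ l) (u : n) :
    (A ^ l) u v = (A ^ l) u w := by
  obtain ⟨k, rfl⟩ := Nat.exists_eq_add_of_le' hl
  simp only [pow_succ, Matrix.mul_apply, h]

/-- The sum over a fibre of `Prod.fst` of a function that is constant on that fibre. -/
theorem sum_ite_fst_eq {α β R : Type*} [Fintype α] [Fintype β] [DecidableEq α] [Semiring R]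
    (f : α × β → R) (v : α × β) (hf : ∀ w, w.1 = v.1 → f w = f v) :
    ∑ w : α × β, (if w.1 = v.1 then f w else 0) = Fintype.card β * f v := by
  rw [Fintype.sum_prod_type, Finset.sum_eq_single v.1]
  · rw [Finset.sum_congr rfl fun a _ => (if_pos rfl).trans (hf (v.1, a) rfl)]
    simp
  · exact fun u _ hu => Finset.sum_eq_zero fun a _ => if_neg hu
  · exact fun h => absurd (Finset.mem_univ _) h

theorem stmt3 (r m : ℕ) (hr : 0 < r) (hm : 0 < m) (p q : ℝ)
    (A : Matrix (Fin r × Fin m) (Fin r × Fin m) ℝ)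
    (hA : ∀ u v : Fin r × Fin m, A u v = if u.1 = v.1 then p else q)
    (l : ℕ) (hl : 1 ≤ l)
    (i j k : Fin r × Fin m) (hij : i.1 = j.1) (hik : i.1 ≠ k.1) :
    (A ^ (l + 1)) i j - (A ^ (l + 1)) i k
      = (m : ℝ) * (p - q) * ((A ^ l) i j - (A ^ l) i k) := by
  have hcol {v w : Fin r × Fin m} (h : v.1 = w.1) : (A ^ l) i v = (A ^ l) i w :=
    A.pow_apply_eq_of_col_eq (fun u => by rw [hA, hA, h]) hl i
  have hsum (v : Fin r × Fin m) :
      ∑ w : Fin r × Fin m, (if w.1 = v.1 then (A ^ l) i w else 0) = m * (A ^ l) i v := by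
    simpa using sum_ite_fst_eq (fun w => (A ^ l) i w) v fun w h => hcol h
  have hstep (v : Fin r × Fin m) : (A ^ (l + 1)) i v
      = (p - q) * (m * (A ^ l) i v) + q * ∑ w, (A ^ l) i w := by
    rw [← hsum, pow_succ, Matrix.mul_apply, Finset.mul_sum, Finset.mul_sum,
      ← Finset.sum_add_distrib]
    refine Finset.sum_congr rfl fun w _ => ?_
    rw [hA]
    split_ifs <;> ring
  rw [hstep, hstep]
  ring
end

section
/- Let r, m be positive integers, p, q real numbers, and A the matrix on V = Fin r × Fin m with A (u,a) (v,b) = p if u = v and q otherwise. Then for every integer l ≥ 1 and all vertices i, j, k ∈ V with i and j in the same cluster and k in a different cluster from i, one has the closed form (A^l)_{ij} − (A^l)_{ik} = m^{l−1}·(p − q)^l. -/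
/-- Right multiplication by a matrix with two block values turns a difference of two entries in a
row into `p - q` times the difference of the corresponding block sums of that row. -/
theorem mul_blockMatrix_sub {ι κ R : Type*} [Fintype ι] [DecidableEq ι] [Fintype κ] [CommRing R]
    {p q : R} {A : Matrix (ι × κ) (ι × κ) R}
    (hA : ∀ u v : ι × κ, A u v = if u.1 = v.1 then p else q)
    (B : Matrix (ι × κ) (ι × κ) R) (i j k : ι × κ) :
    (B * A) i j - (B * A) i k = (p - q) * ∑ a, (B i (j.1, a) - B i (k.1, a)) := by
  have block (v : ι × κ) :
      (B * A) i v = (p - q) * ∑ a, B i (v.1, a) + q * ∑ w, B i w := by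
    have hA' (w : ι × κ) : A w v = (p - q) * (if w.1 = v.1 then 1 else 0) + q := by
      rw [hA]; split_ifs <;> ring
    have hsum : ∑ w : ι × κ, B i w * (if w.1 = v.1 then 1 else 0) = ∑ a, B i (v.1, a) := by
      rw [Fintype.sum_prod_type, Finset.sum_comm]
      simp
    rw [Matrix.mul_apply, ← hsum, Finset.mul_sum, Finset.mul_sum, ← Finset.sum_add_distrib]
    refine Finset.sum_congr rfl fun w _ => ?_
    rw [hA']; ring
  rw [block, block, Finset.sum_sub_distrib]
  ring

theorem stmt4 (r m : ℕ) (hr : 0 < r) (hm : 0 < m) (p q : ℝ)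
    (A : Matrix (Fin r × Fin m) (Fin r × Fin m) ℝ)
    (hA : ∀ u v : Fin r × Fin m, A u v = if u.1 = v.1 then p else q)
    (l : ℕ) (hl : 1 ≤ l)
    (i j k : Fin r × Fin m) (hij : i.1 = j.1) (hik : i.1 ≠ k.1) :
    (A ^ l) i j - (A ^ l) i k = (m : ℝ) ^ (l - 1) * (p - q) ^ l := by
  induction l, hl using Nat.le_induction generalizing j k with
  | base => simp [hA, hij, hij ▸ hik]
  | succ n hn ih =>
    rw [pow_succ A, mul_blockMatrix_sub hA,
      Finset.sum_congr rfl fun a _ => ih (j.1, a) (k.1, a) hij hik]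
    obtain ⟨n, rfl⟩ := Nat.exists_eq_add_of_le' hn
    simp only [Finset.sum_const, Finset.card_univ, Fintype.card_fin, nsmul_eq_mul,
      Nat.add_sub_cancel]
    ring
end

section
/- Let r, m be positive integers, p, q real numbers, and A the matrix on V = Fin r × Fin m with A (u,a) (v,b) = p if u = v and q otherwise. Then for every integer l ≥ 1 and all vertices i, k ∈ V lying in different clusters, the entry of A^l satisfies (A^l)_{ik} = m^{l−1}·( (p + (r − 1)·q)^l − (p − q)^l ) / r. -/
/-- A sum over vertices of a product of two cluster-wise constant weights. -/
theorem sum_clusterIndicator_mul {r m : ℕ} (c d e q : ℝ) (i k : Fin r × Fin m) :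
    ∑ j : Fin r × Fin m,
        (c + if i.1 = j.1 then d else 0) * (q + if j.1 = k.1 then e else 0)
      = (m : ℝ) * (r * (c * q) + c * e + d * q + if i.1 = k.1 then d * e else 0) := by
  simp only [Fintype.sum_prod_type]
  simp only [add_mul, mul_add, ite_mul, mul_ite, zero_mul, mul_zero, Finset.sum_add_distrib,
    Finset.sum_ite_eq, Finset.sum_ite_eq', Finset.mem_univ, if_true, Finset.sum_const,
    Finset.card_univ, Fintype.card_fin, nsmul_eq_mul]
  split_ifs <;> ring

/-- Every entry of a positive power of the weight matrix of the planted partition model. -/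
theorem plantedPartition_pow_succ_apply (r m : ℕ) (hr : 0 < r) (p q : ℝ)
    (A : Matrix (Fin r × Fin m) (Fin r × Fin m) ℝ)
    (hA : ∀ u v : Fin r × Fin m, A u v = if u.1 = v.1 then p else q)
    (n : ℕ) (i k : Fin r × Fin m) :
    (A ^ (n + 1)) i k
      = (m : ℝ) ^ n *
          (((p + ((r : ℝ) - 1) * q) ^ (n + 1) - (p - q) ^ (n + 1)) / (r : ℝ)
            + if i.1 = k.1 then (p - q) ^ (n + 1) else 0) := by
  have hr' : (r : ℝ) ≠ 0 := by positivity
  induction n generalizing k with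
  | zero =>
    rw [zero_add, pow_one, hA]
    split_ifs <;> field_simp <;> ring
  | succ n ih =>
    have hA' : ∀ u v : Fin r × Fin m, A u v = q + if u.1 = v.1 then p - q else 0 := by
      intro u v
      rw [hA]
      split_ifs <;> ring
    rw [pow_succ, Matrix.mul_apply]
    simp only [ih, hA', mul_assoc, ← Finset.mul_sum]
    rw [sum_clusterIndicator_mul]
    split_ifs <;> field_simp <;> ring

theorem stmt7 (r m : ℕ) (hr : 0 < r) (hm : 0 < m) (p q : ℝ)
    (A : Matrix (Fin r × Fin m) (Fin r × Fin m) ℝ)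
    (hA : ∀ u v : Fin r × Fin m, A u v = if u.1 = v.1 then p else q)
    (l : ℕ) (hl : 1 ≤ l)
    (i k : Fin r × Fin m) (hik : i.1 ≠ k.1) :
    (A ^ l) i k
      = (m : ℝ) ^ (l - 1) *
          ((p + ((r : ℝ) - 1) * q) ^ l - (p - q) ^ l) / (r : ℝ) := by
  obtain ⟨n, rfl⟩ := Nat.exists_eq_add_of_le' hl
  rw [plantedPartition_pow_succ_apply r m hr p q A hA, if_neg hik, add_zero,
    Nat.add_sub_cancel, mul_div_assoc]
end
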